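/- Given a critical 3-hypergraph H with |V(H)| ≥ 5, H is circular (i.e., isomorphic to C_3(T_{v(H)}) with v(H) odd) if and only if the primality graph 𝒫(H) contains a cycle among its connected components. Equivalently, H is not circular if and only if all components of 𝒫(H) are paths. -/

import Mathlib

/-- `M` is a module of the hypergraph with vertex set `verts` and edge set `edges`. -/
def IsModule {α : Type*} [DecidableEq α] (verts : Finset α) (edges : Set (Finset α))
    (M : Finset α) : Prop :=
  M ⊆ verts ∧ ∀ e ∈ edges, (e ∩ M).Nonempty → (e \ M).Nonempty →
    ∃ m ∈ M, e ∩ M = {m} ∧ ∀ n ∈ M, (e \ {m}) ∪ {n} ∈ edges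

/-- `(verts, edges)` is a hypergraph: edges are nonempty subsets of `verts`. -/
def IsHypergraph {α : Type*} (verts : Finset α) (edges : Set (Finset α)) : Prop :=
  ∀ e ∈ edges, e ⊆ verts ∧ e.Nonempty

/-- `(verts, edges)` is a 3-hypergraph: edges are 3-element subsets of `verts`. -/
def Is3Hypergraph {α : Type*} (verts : Finset α) (edges : Set (Finset α)) : Prop :=
  ∀ e ∈ edges, e ⊆ verts ∧ e.card = 3

/-- Edges of the subhypergraph induced by `W`. -/
def induceEdges {α : Type*} (W : Finset α) (edges : Set (Finset α)) : Set (Finset α) :=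
  {e ∈ edges | e ⊆ W}

/-- A hypergraph is prime if it has at least 3 vertices and all its modules are trivial. -/
def IsPrime {α : Type*} [DecidableEq α] (verts : Finset α) (edges : Set (Finset α)) : Prop :=
  3 ≤ verts.card ∧ ∀ M, IsModule verts edges M → M = ∅ ∨ M = verts ∨ ∃ v, M = {v}

/-- A prime hypergraph is critical if removing any vertex destroys primality. -/
def IsCritical {α : Type*} [DecidableEq α] (verts : Finset α) (edges : Set (Finset α)) : Prop :=
  IsPrime verts edges ∧
    ∀ v ∈ verts, ¬ IsPrime (verts.erase v) (induceEdges (verts.erase v) edges)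

/-- Adjacency in the primality graph: `v ≠ w` and `H - {v, w}` is prime. -/
def PrimAdj {α : Type*} [DecidableEq α] (verts : Finset α) (edges : Set (Finset α))
    (v w : α) : Prop :=
  v ≠ w ∧ v ∈ verts ∧ w ∈ verts ∧
    IsPrime (verts \ {v, w}) (induceEdges (verts \ {v, w}) edges)


/-- `(verts, arc)` is a tournament: the arc relation is irreflexive and, on distinct
vertices of `verts`, exactly one of `arc x y`, `arc y x` holds. -/
def IsTournament {α : Type*} (verts : Finset α) (arc : α → α → Prop) : Prop :=
  (∀ x, ¬ arc x x) ∧ ∀ x ∈ verts, ∀ y ∈ verts, x ≠ y → (arc x y ↔ ¬ arc y x)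

/-- `M` is a module of the tournament `(verts, arc)`. -/
def TournMod {α : Type*} (verts : Finset α) (arc : α → α → Prop) (M : Finset α) : Prop :=
  M ⊆ verts ∧ ∀ x ∈ M, ∀ y ∈ M, ∀ v ∈ verts, arc x v → arc v y → v ∈ M

/-- The edge set of the C₃-structure of a tournament: the 3-sets inducing a 3-cycle. -/
def c3Edges {α : Type*} [DecidableEq α] (verts : Finset α) (arc : α → α → Prop) :
    Set (Finset α) :=
  {e | ∃ x y z, x ∈ verts ∧ y ∈ verts ∧ z ∈ verts ∧
    x ≠ y ∧ y ≠ z ∧ x ≠ z ∧ arc x y ∧ arc y z ∧ arc z x ∧ e = {x, y, z}}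

/-- Arc relation of the tournament `T_p` on `{0, …, p-1}`: obtained from the transitive
tournament (arcs `i j` for `i < j`) by reversing all arcs between even and odd vertices. -/
def arcT (i j : ℕ) : Prop :=
  (i < j ∧ i % 2 = j % 2) ∨ (j < i ∧ i % 2 ≠ j % 2)

/-- A 3-hypergraph is circular if its order is odd and it is isomorphic to
`C₃(T_{v(H)})`. -/
def IsCircular {α : Type*} [DecidableEq α] (verts : Finset α) (edges : Set (Finset α)) : Prop :=
  Odd verts.card ∧ ∃ f : α → ℕ, Set.InjOn f verts ∧
    verts.image f = Finset.range verts.card ∧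
    ∀ e : Finset α, e ⊆ verts →
      (e ∈ edges ↔ e.image f ∈ c3Edges (Finset.range verts.card) arcT)

theorem modClosed {α : Type*} [DecidableEq α] {W : Finset α} {E : Set (Finset α)}
    {M : Finset α} (hM : IsModule W E M) {u v w : α} (hu : u ∈ M) (hv : v ∈ M) (huv : u ≠ v)
    (he : ({u, v, w} : Finset α) ∈ E) : w ∈ M := by
  by_contra hw
  obtain ⟨m, -, h1, -⟩ := hM.2 _ he ⟨u, by simp [hu]⟩ ⟨w, by simp [hw]⟩
  have a : u ∈ ({m} : Finset α) := by rw [← h1]; simp [hu]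
  have b : v ∈ ({m} : Finset α) := by rw [← h1]; simp [hv]
  simp at a b
  exact huv (a.trans b.symm)

theorem modRestrict {α : Type*} [DecidableEq α] {W W' : Finset α} {E : Set (Finset α)}
    {M : Finset α} (hM : IsModule W (induceEdges W E) M) (hW : W' ⊆ W) :
    IsModule W' (induceEdges W' E) (M ∩ W') := by
  refine ⟨Finset.inter_subset_right, ?_⟩
  rintro e ⟨he, heW⟩ h1 h2
  have hint : e ∩ (M ∩ W') = e ∩ M := by
    ext x; simp only [Finset.mem_inter]
    exact ⟨fun h => ⟨h.1, h.2.1⟩, fun h => ⟨h.1, h.2, heW h.1⟩⟩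
  have hsd : (e \ M).Nonempty := by
    obtain ⟨x, hx⟩ := h2
    simp only [Finset.mem_sdiff, Finset.mem_inter, not_and] at hx
    exact ⟨x, by simp only [Finset.mem_sdiff]; exact ⟨hx.1, fun h => hx.2 h (heW hx.1)⟩⟩
  rw [hint] at h1
  obtain ⟨m, hm, hem, hn⟩ := hM.2 e ⟨he, heW.trans hW⟩ h1 hsd
  have hme : m ∈ e := by
    have : m ∈ e ∩ M := by rw [hem]; simp
    exact (Finset.mem_inter.1 this).1
  refine ⟨m, by simp [hm, heW hme], by rw [hint, hem], ?_⟩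
  intro n hnM
  rw [Finset.mem_inter] at hnM
  refine ⟨(hn n hnM.1).1, ?_⟩
  intro x hx
  simp only [Finset.mem_union, Finset.mem_sdiff, Finset.mem_singleton] at hx
  rcases hx with hx | rfl
  · exact heW hx.1
  · exact hnM.2

/-- In a critical hypergraph, a nontrivial module of `H - x` is the set of any two
distinct neighbours of `x`. -/
theorem nbrs {α : Type*} [DecidableEq α] {V : Finset α} {E : Set (Finset α)}
    (hc : IsCritical V E) (h5 : 5 ≤ V.card) {x : α} (hx : x ∈ V) :
    ∃ M, IsModule (V.erase x) (induceEdges (V.erase x) E) M ∧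
      ∀ y y', PrimAdj V E x y → PrimAdj V E x y' → y ≠ y' → M = {y, y'} := by
  have h := hc.2 x hx
  have hcard : (V.erase x).card = V.card - 1 := Finset.card_erase_of_mem hx
  unfold IsPrime at h
  push Not at h
  obtain ⟨M, hM, h0, h1, h2⟩ := h (by omega)
  refine ⟨M, hM, ?_⟩
  have key : ∀ y, PrimAdj V E x y → (y ∉ M ∧ M = V \ {x, y}) ∨ ∃ z, z ≠ y ∧ M = {y, z} := by
    rintro y ⟨hxy, -, hy, hp⟩
    have hsub : V \ {x, y} ⊆ V.erase x := by
      intro z; simp; tauto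
    have hR := hp.2 _ (modRestrict hM hsub)
    have hMV : ∀ z ∈ M, z ∈ V ∧ z ≠ x := fun z hz => by
      have := hM.1 hz; simp at this; tauto
    have hint : M ∩ (V \ {x, y}) = M.erase y := by
      ext z; simp
      constructor
      · tauto
      · intro hz; have := hMV z hz.2; tauto
    rw [hint] at hR
    by_cases hyM : y ∈ M
    · right
      rcases hR with h | h | ⟨v, h⟩
      · exfalso
        rw [Finset.erase_eq_empty_iff] at h
        rcases h with h | h
        · exact absurd h h0.ne_empty
        · exact h2 y h
      · exfalso
        apply h1
        ext z
        by_cases hzy : z = y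
        · subst hzy; simp [hyM, hy]; exact fun h => hxy h.symm
        · have : z ∈ M.erase y ↔ z ∈ V \ {x, y} := by rw [h]
          simp [hzy] at this ⊢
          tauto
      · refine ⟨v, ?_, ?_⟩
        · have : v ∈ M.erase y := by rw [h]; simp
          simp at this; exact this.1
        · rw [← h, Finset.insert_erase hyM]
    · left
      rw [Finset.erase_eq_of_notMem hyM] at hR
      rcases hR with h | h | ⟨v, h⟩
      · exact absurd h h0.ne_empty
      · exact ⟨hyM, h⟩
      · exact absurd h (h2 v)
  intro y y' hy hy' hne
  have big : ∀ z, PrimAdj V E x z → M = V \ {x, z} → 3 ≤ M.card := by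
    intro z hz h
    rw [h]; exact hz.2.2.2.1
  rcases key y hy with ⟨a, b⟩ | ⟨z, hz, b⟩
  · rcases key y' hy' with ⟨c, d⟩ | ⟨z', hz', d⟩
    · exfalso; apply c; rw [b]; simp [hy'.2.2.1, hy'.1.symm, hne.symm]
    · have := big y hy b
      rw [d] at this
      have := Finset.card_le_two (a := y') (b := z')
      omega
  · rcases key y' hy' with ⟨c, d⟩ | ⟨z', hz', d⟩
    · have := big y' hy' d
      rw [b] at this
      have := Finset.card_le_two (a := y) (b := z)
      omega
    · have : y ∈ ({y', z'} : Finset α) := by rw [← d, b]; simp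
      simp [hne] at this
      subst this
      rw [d, Finset.pair_comm]

theorem PrimAdj.symm' {α : Type*} [DecidableEq α] {V : Finset α} {E : Set (Finset α)}
    {x y : α} (h : PrimAdj V E x y) : PrimAdj V E y x := by
  obtain ⟨a, b, c, d⟩ := h
  refine ⟨a.symm, c, b, ?_⟩
  rwa [Finset.pair_comm]

/-- The consequences of a pair being a module of `H - x`. -/
theorem pair_facts {α : Type*} [DecidableEq α] {V : Finset α} {E : Set (Finset α)}
    (h3 : Is3Hypergraph V E) {x y y' : α} (hne : y ≠ y')
    (hyx : y ≠ x) (hyx' : y' ≠ x)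
    (hM : IsModule (V.erase x) (induceEdges (V.erase x) E) {y, y'}) :
    (∀ u, u ≠ x → ({y, y', u} : Finset α) ∉ E) ∧
    (∀ u w, u ≠ x → w ≠ x → (({y, u, w} : Finset α) ∈ E → ({y', u, w} : Finset α) ∈ E)) := by
  have A : ∀ u, u ≠ x → ({y, y', u} : Finset α) ∉ E := by
    intro u hu he
    have hs := h3 _ he
    have hm : u ∈ ({y, y'} : Finset α) := by
      refine modClosed hM (u := y) (v := y') (by simp) (by simp) hne ⟨he, ?_⟩
      intro z hz
      have := hs.1 hz
      simp only [Finset.mem_insert, Finset.mem_singleton] at hz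
      rw [Finset.mem_erase]
      exact ⟨by rcases hz with rfl | rfl | rfl <;> assumption, this⟩
    have : ({y, y', u} : Finset α) ⊆ {y, y'} := by
      intro z hz; simp at hz hm ⊢; grind
    have := Finset.card_le_card this
    have := Finset.card_le_two (a := y) (b := y')
    omega
  refine ⟨A, ?_⟩
  intro u w hu hw he
  have hs := h3 _ he
  have hc3 := hs.2
  rw [Finset.card_eq_three] at hc3
  have hyu : y ≠ u := by
    rintro rfl
    have := hs.2
    have h2 := Finset.card_le_two (a := y) (b := w)
    simp at this; omega
  have hyw : y ≠ w := by
    rintro rfl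
    have := hs.2
    have h2 := Finset.card_le_two (a := y) (b := u)
    rw [Finset.pair_comm u y] at this
    simp at this; omega
  have hu' : u ≠ y' := by
    rintro rfl
    exact A w hw he
  have hw' : w ≠ y' := by
    rintro rfl
    apply A u hu
    rwa [Finset.pair_comm w u]
  obtain ⟨m, hm, h1, h2⟩ := hM.2 {y, u, w} ⟨he, by
      intro z hz
      have := hs.1 hz
      simp only [Finset.mem_insert, Finset.mem_singleton] at hz
      rw [Finset.mem_erase]
      exact ⟨by rcases hz with rfl | rfl | rfl <;> assumption, this⟩⟩
    ⟨y, by simp⟩ ⟨u, by simp; exact ⟨hyu.symm, hu'⟩⟩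
  have hmy : y ∈ ({m} : Finset α) := by rw [← h1]; simp
  simp at hmy
  subst hmy
  have := (h2 y' (by simp)).1
  convert this using 1
  ext z
  simp
  grind

/-- The circular hypergraphs are prime. -/
theorem circ_prime {α : Type*} [DecidableEq α] {W : Finset α} {E : Set (Finset α)}
    {p : ℕ} (hp : 3 ≤ p) (hodd : p % 2 = 1) (h : ℕ → α) (hinj : Set.InjOn h (Set.Iio p))
    (hW : W = (Finset.range p).image h)
    (hE : ∀ a b c, a < b → b < c → c < p → a % 2 ≠ b % 2 → b % 2 ≠ c % 2 →
      ({h a, h b, h c} : Finset α) ∈ E) :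
    IsPrime W (induceEdges W E) := by
  have hcard : W.card = p := by
    rw [hW, Finset.card_image_of_injOn, Finset.card_range]
    simpa using hinj
  refine ⟨by omega, ?_⟩
  intro M hM
  by_cases hM1 : M.card ≤ 1
  · rcases Nat.lt_or_ge M.card 1 with h0 | h0
    · left; exact Finset.card_eq_zero.1 (by omega)
    · right; right; exact Finset.card_eq_one.1 (by omega)
  right; left
  have hmem : ∀ i, i < p → h i ∈ W := fun i hi => by
    rw [hW]; exact Finset.mem_image_of_mem _ (by simpa using hi)
  have hne : ∀ i j, i < p → j < p → i ≠ j → h i ≠ h j := fun i j hi hj hij e =>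
    hij (hinj hi hj e)
  have hE' : ∀ a b c, a < b → b < c → c < p → a % 2 ≠ b % 2 → b % 2 ≠ c % 2 →
      ({h a, h b, h c} : Finset α) ∈ induceEdges W E := by
    intro a b c h1 h2 h3 h4 h5
    refine ⟨hE a b c h1 h2 h3 h4 h5, ?_⟩
    intro z hz
    simp only [Finset.mem_insert, Finset.mem_singleton] at hz
    rcases hz with rfl | rfl | rfl
    · exact hmem _ (by omega)
    · exact hmem _ (by omega)
    · exact hmem _ (by omega)
  have up : ∀ a b c, h a ∈ M → h b ∈ M → a < b → b < c → c < p → a % 2 ≠ b % 2 →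
      b % 2 ≠ c % 2 → h c ∈ M := by
    intro a b c ha hb h1 h2 h3 h4 h5
    exact modClosed hM ha hb (hne _ _ (by omega) (by omega) (by omega)) (hE' a b c h1 h2 h3 h4 h5)
  have mid : ∀ a b c, h a ∈ M → h c ∈ M → a < b → b < c → c < p → a % 2 ≠ b % 2 →
      b % 2 ≠ c % 2 → h b ∈ M := by
    intro a b c ha hb h1 h2 h3 h4 h5
    refine modClosed hM ha hb (hne _ _ (by omega) (by omega) (by omega)) ?_
    rw [Finset.pair_comm]
    exact (hE' a b c h1 h2 h3 h4 h5)
  have dn : ∀ a b c, h b ∈ M → h c ∈ M → a < b → b < c → c < p → a % 2 ≠ b % 2 →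
      b % 2 ≠ c % 2 → h a ∈ M := by
    intro a b c ha hb h1 h2 h3 h4 h5
    refine modClosed hM ha hb (hne _ _ (by omega) (by omega) (by omega)) ?_
    rw [Finset.pair_comm, Finset.insert_comm]
    exact (hE' a b c h1 h2 h3 h4 h5)
  have case1 : ∀ a b, h a ∈ M → h b ∈ M → a < b → b < p → a % 2 = 0 → b % 2 = 1 →
      ∀ c < p, h c ∈ M := by
    intro a b ha hb hab hbp ha0 hb1
    have hl : h (p-1) ∈ M := up a b (p-1) ha hb hab (by omega) (by omega) (by omega) (by omega)
    have h0 : h 0 ∈ M := dn 0 b (p-1) hb hl (by omega) (by omega) (by omega) (by omega) (by omega)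
    have ho : ∀ c < p, c % 2 = 1 → h c ∈ M := fun c hc hc1 =>
      mid 0 c (p-1) h0 hl (by omega) (by omega) (by omega) (by omega) (by omega)
    intro c hc
    by_cases hc1 : c % 2 = 1
    · exact ho c hc hc1
    by_cases hcl : c = p - 1
    · rwa [hcl]
    · exact dn c (p-2) (p-1) (ho (p-2) (by omega) (by omega)) hl (by omega) (by omega) (by omega)
        (by omega) (by omega)
  have case2 : ∀ a b, h a ∈ M → h b ∈ M → a < b → b < p → a % 2 ≠ b % 2 →
      ∀ c < p, h c ∈ M := by
    intro a b ha hb hab hbp hpar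
    by_cases ha0 : a % 2 = 0
    · exact case1 a b ha hb hab hbp ha0 (by omega)
    · have h0 : h 0 ∈ M := dn 0 a b ha hb (by omega) hab hbp (by omega) hpar
      exact case1 0 a h0 ha (by omega) (by omega) (by omega) (by omega)
  have case3 : ∀ a b, h a ∈ M → h b ∈ M → a < b → b < p → ∀ c < p, h c ∈ M := by
    intro a b ha hb hab hbp
    by_cases hpar : a % 2 = b % 2
    · have h1 : h (a+1) ∈ M :=
        mid a (a+1) b ha hb (by omega) (by omega) hbp (by omega) (by omega)
      exact case2 a (a+1) ha h1 (by omega) (by omega) (by omega)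
    · exact case2 a b ha hb hab hbp hpar
  obtain ⟨u, hu, v, hv, huv⟩ := Finset.one_lt_card.1 (by omega : 1 < M.card)
  have hu' := hM.1 hu
  have hv' := hM.1 hv
  rw [hW, Finset.mem_image] at hu' hv'
  obtain ⟨a, ha, rfl⟩ := hu'
  obtain ⟨b, hb, rfl⟩ := hv'
  rw [Finset.mem_range] at ha hb
  have all : ∀ c < p, h c ∈ M := by
    rcases lt_trichotomy a b with hab | hab | hab
    · exact case3 a b hu hv hab hb
    · subst hab; exact absurd rfl huv
    · exact case3 b a hv hu hab ha
  refine Finset.Subset.antisymm hM.1 ?_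
  intro z hz
  rw [hW, Finset.mem_image] at hz
  obtain ⟨c, hc, rfl⟩ := hz
  exact all c (by simpa using hc)

theorem c3_iff (p : ℕ) (e : Finset ℕ) : e ∈ c3Edges (Finset.range p) arcT ↔
    ∃ a b c, a < b ∧ b < c ∧ c < p ∧ a % 2 ≠ b % 2 ∧ b % 2 ≠ c % 2 ∧ e = {a, b, c} := by
  constructor
  · rintro ⟨x, y, z, hx, hy, hz, h1, h2, h3, h4, h5, h6, rfl⟩
    simp only [Finset.mem_range] at hx hy hz
    unfold arcT at h4 h5 h6
    have : (x < z ∧ z < y) ∨ (y < x ∧ x < z) ∨ (z < y ∧ y < x) := by omega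
    rcases this with h | h | h
    · exact ⟨x, z, y, by omega, by omega, by omega, by omega, by omega, by
        rw [Finset.pair_comm]⟩
    · exact ⟨y, x, z, by omega, by omega, by omega, by omega, by omega, by
        rw [Finset.insert_comm]⟩
    · exact ⟨z, y, x, by omega, by omega, by omega, by omega, by omega, by
        ext t; simp; tauto⟩
  · rintro ⟨a, b, c, h1, h2, h3, h4, h5, rfl⟩
    refine ⟨a, c, b, by simp; omega, by simp; omega, by simp; omega, by omega, by omega, by omega,
      ?_, ?_, ?_, by rw [Finset.pair_comm]⟩ <;> unfold arcT <;> omega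

theorem forward {α : Type*} [DecidableEq α]
    (verts : Finset α) (edges : Set (Finset α)) 
    (hc : IsCritical verts edges) (h5 : 5 ≤ verts.card) (h : IsCircular verts edges) :
      ∃ (m : ℕ) (ψ : ℕ → α), 3 ≤ m ∧ Set.InjOn ψ (Set.Iio m) ∧
        (∀ i < m, ψ i ∈ verts) ∧
        (∀ i < m, ∀ j < m, (PrimAdj verts edges (ψ i) (ψ j) ↔
          (j = (i + 1) % m ∨ i = (j + 1) % m))) ∧
        (∀ i < m, ∀ w, PrimAdj verts edges (ψ i) w → ∃ j < m, w = ψ j) := by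
  obtain ⟨hodd, f, hf, him, hE⟩ := h
  set m := verts.card with hm
  have hodd' : m % 2 = 1 := Nat.odd_iff.1 hodd
  have ex : ∀ i, ∃ v, i < m → v ∈ verts ∧ f v = i := by
    intro i
    by_cases hi : i < m
    · have : i ∈ verts.image f := by rw [him]; simpa using hi
      obtain ⟨v, hv, h⟩ := Finset.mem_image.1 this
      exact ⟨v, fun _ => ⟨hv, h⟩⟩
    · have : 0 < verts.card := by omega
      obtain ⟨v, hv⟩ := Finset.card_pos.1 this
      exact ⟨v, fun h => absurd h hi⟩
  choose ψ hψ using ex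
  have hinj : Set.InjOn ψ (Set.Iio m) := by
    intro i hi j hj hij
    rw [← (hψ i hi).2, ← (hψ j hj).2, hij]
  have hsurj : ∀ w ∈ verts, ∃ j < m, w = ψ j := by
    intro w hw
    have : f w ∈ Finset.range m := by rw [← him]; exact Finset.mem_image_of_mem _ hw
    rw [Finset.mem_range] at this
    exact ⟨f w, this, hf hw (hψ _ this).1 (hψ _ this).2.symm⟩
  have hEd : ∀ a b c, a < b → b < c → c < m → a % 2 ≠ b % 2 → b % 2 ≠ c % 2 →
      ({ψ a, ψ b, ψ c} : Finset α) ∈ edges := by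
    intro a b c h1 h2 h3 h4 h5
    rw [hE, c3_iff]
    · refine ⟨a, b, c, h1, h2, h3, h4, h5, ?_⟩
      simp only [Finset.image_insert, Finset.image_singleton]
      rw [(hψ a (by omega)).2, (hψ b (by omega)).2, (hψ c (by omega)).2]
    · intro z hz
      simp only [Finset.mem_insert, Finset.mem_singleton] at hz
      rcases hz with rfl | rfl | rfl
      · exact (hψ a (by omega)).1
      · exact (hψ b (by omega)).1
      · exact (hψ c (by omega)).1
  have adj1 : ∀ i, i + 1 < m → PrimAdj verts edges (ψ i) (ψ (i+1)) := by
    intro i hi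
    refine ⟨fun h => by have := hinj (by simp; omega) (by simp; omega) h; omega,
      (hψ i (by omega)).1, (hψ _ hi).1, ?_⟩
    apply circ_prime (p := m - 2) (by omega) (by omega) (fun t => ψ (if t < i then t else t + 2))
    · intro a ha b hb hab
      simp only [Set.mem_Iio] at ha hb
      have := hinj (by simp; split_ifs <;> omega) (by simp; split_ifs <;> omega) hab
      split_ifs at this <;> omega
    · ext w
      simp only [Finset.mem_sdiff, Finset.mem_image, Finset.mem_range, Finset.mem_insert,
        Finset.mem_singleton]
      constructor
      · rintro ⟨hw, hw'⟩
        obtain ⟨j, hj, rfl⟩ := hsurj w hw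
        have hji : j ≠ i := by rintro rfl; tauto
        have hji' : j ≠ i + 1 := by rintro rfl; tauto
        by_cases hlt : j < i
        · exact ⟨j, by omega, by simp [hlt]⟩
        · refine ⟨j - 2, by omega, ?_⟩
          rw [if_neg (by omega)]
          congr 1; omega
      · rintro ⟨t, ht, rfl⟩
        refine ⟨(hψ _ (by split_ifs <;> omega)).1, ?_⟩
        rintro (h | h)
        · have := hinj (by simp; split_ifs <;> omega) (by simp; omega) h
          split_ifs at this <;> omega
        · have := hinj (by simp; split_ifs <;> omega) (by simp; omega) h
          split_ifs at this <;> omega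
    · intro a b c h1 h2 h3 h4 h5
      apply hEd <;> split_ifs <;> omega
  have adj2 : PrimAdj verts edges (ψ (m-1)) (ψ 0) := by
    refine ⟨fun h => by have := hinj (by simp; omega) (by simp; omega) h; omega,
      (hψ _ (by omega)).1, (hψ _ (by omega)).1, ?_⟩
    apply circ_prime (p := m - 2) (by omega) (by omega) (fun t => ψ (t + 1))
    · intro a ha b hb hab
      simp only [Set.mem_Iio] at ha hb
      have := hinj (by simp; omega) (by simp; omega) hab
      omega
    · ext w
      simp only [Finset.mem_sdiff, Finset.mem_image, Finset.mem_range, Finset.mem_insert,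
        Finset.mem_singleton]
      constructor
      · rintro ⟨hw, hw'⟩
        obtain ⟨j, hj, rfl⟩ := hsurj w hw
        have hji : j ≠ m - 1 := by rintro rfl; tauto
        have hji' : j ≠ 0 := by rintro rfl; tauto
        refine ⟨j - 1, by omega, ?_⟩
        congr 1; omega
      · rintro ⟨t, ht, rfl⟩
        refine ⟨(hψ _ (by omega)).1, ?_⟩
        rintro (h | h)
        · have := hinj (by simp; omega) (by simp; omega) h
          omega
        · have := hinj (by simp; omega) (by simp; omega) h
          omega
    · intro a b c h1 h2 h3 h4 h5
      apply hEd <;> omega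
  have adj : ∀ i < m, PrimAdj verts edges (ψ i) (ψ ((i+1) % m)) := by
    intro i hi
    by_cases h : i + 1 < m
    · rw [Nat.mod_eq_of_lt h]; exact adj1 i h
    · have : i = m - 1 := by omega
      subst this
      rw [show m - 1 + 1 = m by omega, Nat.mod_self]
      exact adj2
  refine ⟨m, ψ, by omega, hinj, fun i hi => (hψ i hi).1, ?_, fun i hi w hw => hsurj w hw.2.2.1⟩
  intro i hi j hj
  constructor
  · intro hij
    obtain ⟨k, hk, hki⟩ : ∃ k < m, i = (k + 1) % m := by
      by_cases h0 : i = 0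
      · exact ⟨m - 1, by omega, by rw [show m - 1 + 1 = m by omega, Nat.mod_self, h0]⟩
      · exact ⟨i - 1, by omega, by rw [Nat.mod_eq_of_lt] <;> omega⟩
    have hA := adj i hi
    have hB : PrimAdj verts edges (ψ i) (ψ k) := by
      have := (adj k hk).symm'
      rwa [← hki] at this
    have hlt : (i + 1) % m < m := Nat.mod_lt _ (by omega)
    have hkne : (i + 1) % m ≠ k := by
      intro h
      by_cases h1 : i + 1 < m
      · rw [Nat.mod_eq_of_lt h1] at h
        by_cases h2 : k + 1 < m
        · rw [Nat.mod_eq_of_lt h2] at hki; omega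
        · have : k + 1 = m := by omega
          rw [this, Nat.mod_self] at hki; omega
      · have : i + 1 = m := by omega
        rw [this, Nat.mod_self] at h
        rw [Nat.mod_eq_of_lt (by omega)] at hki
        omega
    obtain ⟨M, -, hM⟩ := nbrs hc h5 (hψ i hi).1
    have e1 := hM _ _ hA hB (fun h => hkne (hinj hlt hk h))
    by_cases hj1 : j = (i+1) % m
    · left; exact hj1
    · right
      have e2 := hM _ _ hA hij (fun h => hj1 (hinj hlt hj h).symm)
      have : ψ j ∈ ({ψ ((i+1) % m), ψ k} : Finset α) := by rw [← e1, e2]; simp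
      simp only [Finset.mem_insert, Finset.mem_singleton] at this
      rcases this with h | h
      · exact absurd (hinj hj hlt h) hj1
      · rw [hinj hj hk h]; exact hki
  · rintro (rfl | rfl)
    · exact adj i hi
    · exact PrimAdj.symm' (adj j hj)

/-- Moving a vertex along the cycle by steps of length two. -/
theorem mv {α : Type*} [DecidableEq α] {E : Set (Finset α)} {φ : ℕ → α}
    (F1 : ∀ i u w, u ≠ φ (i+1) → w ≠ φ (i+1) →
      (({φ i, u, w} : Finset α) ∈ E ↔ ({φ (i+2), u, w} : Finset α) ∈ E))
    (i k : ℕ) (u w : α) (hu : ∀ t < k, u ≠ φ (i + 2*t + 1)) (hw : ∀ t < k, w ≠ φ (i + 2*t + 1)) :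
    (({φ i, u, w} : Finset α) ∈ E ↔ ({φ (i+2*k), u, w} : Finset α) ∈ E) := by
  induction k with
  | zero => simp
  | succ k ih =>
    rw [ih (fun t ht => hu t (by omega)) (fun t ht => hw t (by omega)),
      F1 (i+2*k) u w (hu k (by omega)) (hw k (by omega))]
    rw [show i + 2*k + 2 = i + 2*(k+1) by ring]

theorem zz {α : Type*} [DecidableEq α] {E : Set (Finset α)} {φ : ℕ → α}
    (F1 : ∀ i u w, u ≠ φ (i+1) → w ≠ φ (i+1) →
      (({φ i, u, w} : Finset α) ∈ E ↔ ({φ (i+2), u, w} : Finset α) ∈ E))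
    (F2 : ∀ i u, u ≠ φ (i+1) → ({φ i, φ (i+2), u} : Finset α) ∉ E)
    (i k : ℕ) (hk : 1 ≤ k) (u : α) (hi : ∀ t < k, φ i ≠ φ (i + 2*t + 1))
    (hu : ∀ t < k, u ≠ φ (i + 2*t + 1)) :
    ({φ i, φ (i+2*k), u} : Finset α) ∉ E := by
  rw [Finset.insert_comm]
  obtain ⟨k, rfl⟩ : ∃ l, k = l + 1 := ⟨k - 1, by omega⟩
  rw [show i + 2*(k+1) = (i+2) + 2*k by ring, ← mv F1 (i+2) k, Finset.insert_comm]
  · exact F2 i u (hu 0 (by omega))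
  · intro t ht
    have := hi (t+1) (by omega)
    rwa [show i + 2*(t+1) + 1 = i + 2 + 2*t + 1 by ring] at this
  · intro t ht
    have := hu (t+1) (by omega)
    rwa [show i + 2*(t+1) + 1 = i + 2 + 2*t + 1 by ring] at this

/-- A criterion for being a module of a 3-hypergraph. -/
theorem mkModule {α : Type*} [DecidableEq α] {V : Finset α} {E : Set (Finset α)}
    (h3 : Is3Hypergraph V E) {M : Finset α} (hMV : M ⊆ V)
    (h1 : ∀ a ∈ M, ∀ b ∈ M, a ≠ b → ∀ u, u ∉ M → ({a, b, u} : Finset α) ∉ E)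
    (h2 : ∀ a ∈ M, ∀ b ∈ M, a ≠ b → ∀ u w, u ∉ M → w ∉ M → ({a, u, w} : Finset α) ∈ E →
      ({b, u, w} : Finset α) ∈ E) : IsModule V E M := by
  refine ⟨hMV, ?_⟩
  rintro e he ⟨a, ha⟩ ⟨u, hu⟩
  rw [Finset.mem_inter] at ha
  rw [Finset.mem_sdiff] at hu
  have hau : a ≠ u := by rintro rfl; exact hu.2 ha.2
  obtain ⟨w, hwe⟩ : ∃ w, e = {a, u, w} := by
    obtain ⟨x, y, z, hxy, hxz, hyz, rfl⟩ := Finset.card_eq_three.1 (h3 e he).2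
    have h1 := ha.1
    have h2 := hu.1
    simp only [Finset.mem_insert, Finset.mem_singleton] at h1 h2
    have : ∀ w, (({x, y, z} : Finset α) = {a, u, w}) ↔
      ∀ t, (t = x ∨ t = y ∨ t = z) ↔ (t = a ∨ t = u ∨ t = w) := by
      intro w; rw [Finset.ext_iff]; simp
    simp only [this]
    rcases h1 with rfl | rfl | rfl <;> rcases h2 with rfl | rfl | rfl <;>
      first
      | exact absurd rfl hau
      | exact ⟨x, by tauto⟩
      | exact ⟨y, by tauto⟩
      | exact ⟨z, by tauto⟩
  have hc := (h3 e he).2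
  subst hwe
  have haw : a ≠ w := by
    rintro rfl
    rw [Finset.pair_comm] at hc
    have := Finset.card_le_two (a := a) (b := u)
    simp at hc; omega
  have hwM : w ∉ M := by
    intro hw
    apply h1 a ha.2 w hw haw u hu.2
    rwa [Finset.pair_comm]
  refine ⟨a, ha.2, ?_, ?_⟩
  · ext t
    simp only [Finset.mem_inter, Finset.mem_insert, Finset.mem_singleton]
    constructor
    · rintro ⟨rfl | rfl | rfl, h⟩
      · rfl
      · exact absurd h hu.2
      · exact absurd h hwM
    · rintro rfl; exact ⟨Or.inl rfl, ha.2⟩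
  · intro b hb
    have e1 : ({a, u, w} : Finset α) \ {a} ∪ {b} = {b, u, w} := by
      ext t
      simp only [Finset.mem_union, Finset.mem_sdiff, Finset.mem_insert, Finset.mem_singleton]
      constructor
      · tauto
      · rintro (rfl | rfl | rfl)
        · tauto
        · left; exact ⟨by tauto, hau.symm⟩
        · left; exact ⟨by tauto, haw.symm⟩
    rw [e1]
    by_cases hab : a = b
    · rwa [← hab]
    · exact h2 a ha.2 b hb hab u w hu.2 hwM he

theorem wlog_lt {P : ℕ → ℕ → Prop} (hs : ∀ i j, P i j → P j i) (h : ∀ i j, i < j → P i j)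
    (i j : ℕ) (hij : i ≠ j) : P i j := by
  rcases Nat.lt_or_gt_of_ne hij with a | a
  · exact h i j a
  · exact hs _ _ (h j i a)

set_option maxHeartbeats 4000000 in
theorem backward {α : Type*} [DecidableEq α]
    (verts : Finset α) (edges : Set (Finset α)) (h3 : Is3Hypergraph verts edges)
    (hc : IsCritical verts edges) (h5 : 5 ≤ verts.card)
    (m : ℕ) (ψ : ℕ → α) (hm : 3 ≤ m) (hinj : Set.InjOn ψ (Set.Iio m))
    (hV : ∀ i < m, ψ i ∈ verts)
    (hadj : ∀ i < m, ∀ j < m, (PrimAdj verts edges (ψ i) (ψ j) ↔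
          (j = (i + 1) % m ∨ i = (j + 1) % m))) :
    IsCircular verts edges := by
  have hm0 : 0 < m := by omega
  obtain ⟨φ, hφ⟩ : ∃ φ : ℕ → α, ∀ i, φ i = ψ (i % m) := ⟨_, fun i => rfl⟩
  have hφinj : ∀ i j, φ i = φ j → i % m = j % m := by
    intro i j h
    rw [hφ, hφ] at h
    exact hinj (Nat.mod_lt _ hm0) (Nat.mod_lt _ hm0) h
  -- distinctness for indices within distance less than `m`
  have hφne : ∀ i j, i < j → j < i + m → φ i ≠ φ j := by
    intro i j h1 h2 h
    have h := hφinj i j h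
    have : m ∣ j - i := (Nat.modEq_iff_dvd' h1.le).1 h
    have := Nat.le_of_dvd (by omega) this
    omega
  have hper : ∀ i, φ (i + m) = φ i := by
    intro i; rw [hφ, hφ, Nat.add_mod_right]
  have hsm : ∀ i < m, φ i = ψ i := fun i hi => by rw [hφ, Nat.mod_eq_of_lt hi]
  have hφV : ∀ i, φ i ∈ verts := fun i => by rw [hφ]; exact hV _ (Nat.mod_lt _ hm0)
  have hA : ∀ i, PrimAdj verts edges (φ i) (φ (i+1)) := by
    intro i
    rw [hφ, hφ, hadj _ (Nat.mod_lt _ hm0) _ (Nat.mod_lt _ hm0)]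
    left; simp
  have hmod : ∀ i, IsModule (verts.erase (φ (i+1))) (induceEdges (verts.erase (φ (i+1))) edges)
      {φ i, φ (i+2)} := by
    intro i
    obtain ⟨M, hM, h⟩ := nbrs hc h5 (hφV (i+1))
    rw [← h _ _ (hA i).symm' (hA (i+1)) (hφne _ _ (by omega) (by omega))]
    exact hM
  have F2 : ∀ i u, u ≠ φ (i+1) → ({φ i, φ (i+2), u} : Finset α) ∉ edges := fun i =>
    (pair_facts h3 (hφne _ _ (by omega) (by omega)) (hφne _ _ (by omega) (by omega))
      (hφne _ _ (by omega) (by omega)).symm (hmod i)).1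
  have F1 : ∀ i u w, u ≠ φ (i+1) → w ≠ φ (i+1) →
      (({φ i, u, w} : Finset α) ∈ edges ↔ ({φ (i+2), u, w} : Finset α) ∈ edges) := by
    intro i u w hu hw
    constructor
    · exact (pair_facts h3 (hφne _ _ (by omega) (by omega)) (hφne _ _ (by omega) (by omega))
        (hφne _ _ (by omega) (by omega)).symm (hmod i)).2 u w hu hw
    · refine (pair_facts h3 (x := φ (i+1)) (hφne _ _ (by omega) (by omega)).symm
        (hφne _ _ (by omega) (by omega)).symm (hφne _ _ (by omega) (by omega)) ?_).2 u w hu hw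
      rw [Finset.pair_comm]; exact hmod i
  have MV := mv F1
  have ZZ : ∀ i k, 1 ≤ k → 2 * k ≤ m → ∀ u, (∀ t < k, u ≠ φ (i + 2*t + 1)) →
      ({φ i, φ (i+2*k), u} : Finset α) ∉ edges := by
    intro i k hk hkm u hu
    exact zz F1 F2 i k hk u (fun t ht => hφne _ _ (by omega) (by omega)) hu
  rcases Nat.mod_two_eq_zero_or_one m with hpar | hpar
  · -- even length: the even vertices form a nontrivial module
    exfalso
    have B : ∀ i j, i ≠ j → i < m → j < m → i % 2 = j % 2 → ∀ u,
        (∀ l < m, u = φ l → l % 2 ≠ i % 2) → ({φ i, φ j, u} : Finset α) ∉ edges := by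
      refine wlog_lt ?_ ?_
      · intro i j h h1 h2 h4 u hu
        rw [Finset.insert_comm]
        exact h h2 h1 h4.symm u (by rwa [← h4])
      · intro i j hij hi hj hp u hu
        by_cases hmid : ∃ o, i < o ∧ o < j ∧ u = φ o
        · obtain ⟨o, ho1, ho2, rfl⟩ := hmid
          have := ZZ j ((i + m - j)/2) (by omega) (by omega) (φ o)
            (fun t ht => hφne _ _ (by omega) (by omega))
          rwa [show j + 2 * ((i+m-j)/2) = i + m by omega, hper, Finset.insert_comm] at this
        · have := ZZ i ((j - i)/2) (by omega) (by omega) u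
            (fun t ht h => hmid ⟨_, by omega, by omega, h⟩)
          rwa [show i + 2 * ((j - i)/2) = j by omega] at this
    have A : ∀ i j, i ≠ j → i < m → j < m → i % 2 = j % 2 → ∀ u w,
        (∀ l < m, w ≠ φ l) → 
        (({φ i, u, w} : Finset α) ∈ edges ↔ ({φ j, u, w} : Finset α) ∈ edges) := by
      refine wlog_lt ?_ ?_
      · intro i j h h1 h2 h4 u w hw
        exact (h h2 h1 h4.symm u w hw).symm
      · intro i j hij hi hj hp u w hw
        have hw' : ∀ l, w ≠ φ l := by
          intro l h
          apply hw (l % m) (Nat.mod_lt _ hm0)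
          rw [h, hφ, hφ, Nat.mod_mod]
        by_cases hmid : ∃ o, i < o ∧ o < j ∧ u = φ o
        · obtain ⟨o, ho1, ho2, rfl⟩ := hmid
          have := MV j ((i + m - j)/2) (φ o) w
            (fun t ht => hφne _ _ (by omega) (by omega)) (fun t ht => hw' _)
          rw [show j + 2 * ((i+m-j)/2) = i + m by omega, hper] at this
          exact this.symm
        · have := MV i ((j - i)/2) u w
            (fun t ht h => hmid ⟨_, by omega, by omega, h⟩) (fun t ht => hw' _)
          rwa [show i + 2 * ((j - i)/2) = j by omega] at this
    let M : Finset α := ((Finset.range m).filter (fun i => i % 2 = 0)).image φ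
    have hMmem : ∀ v, v ∈ M ↔ ∃ i, i < m ∧ i % 2 = 0 ∧ φ i = v := by
      intro v; simp [M, and_assoc]
    have hMmod : IsModule verts edges M := by
      apply mkModule h3
      · intro v hv
        obtain ⟨i, -, -, rfl⟩ := (hMmem v).1 hv
        exact hφV i
      · intro a ha b hb hab u hu
        obtain ⟨i, hi, hi2, rfl⟩ := (hMmem a).1 ha
        obtain ⟨j, hj, hj2, rfl⟩ := (hMmem b).1 hb
        refine B i j (by rintro rfl; exact hab rfl) hi hj (by omega) u ?_
        rintro l hl rfl hp
        exact hu ((hMmem _).2 ⟨l, hl, by omega, rfl⟩)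
      · intro a ha b hb hab u w hu hw he
        obtain ⟨i, hi, hi2, rfl⟩ := (hMmem a).1 ha
        obtain ⟨j, hj, hj2, rfl⟩ := (hMmem b).1 hb
        have hij : i ≠ j := by rintro rfl; exact hab rfl
        by_cases hwC : ∀ l < m, w ≠ φ l
        · exact (A i j hij hi hj (by omega) u w hwC).1 he
        by_cases huC : ∀ l < m, u ≠ φ l
        · rw [Finset.pair_comm]
          rw [Finset.pair_comm] at he
          exact (A i j hij hi hj (by omega) w u huC).1 he
        exfalso
        push Not at hwC huC
        obtain ⟨k, hk, rfl⟩ := hwC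
        obtain ⟨l, hl, rfl⟩ := huC
        have hk1 : k % 2 = 1 := by
          by_contra h; exact hw ((hMmem _).2 ⟨k, hk, by omega, rfl⟩)
        have hl1 : l % 2 = 1 := by
          by_contra h; exact hu ((hMmem _).2 ⟨l, hl, by omega, rfl⟩)
        by_cases hkl : k = l
        · subst hkl
          have h1 := (h3 _ he).2
          have h2 := Finset.card_le_two (a := φ i) (b := φ k)
          simp at h1; omega
        · apply B l k (Ne.symm hkl) hl hk (by omega) (φ i)
          · intro o ho h
            have := hφinj _ _ h
            rw [Nat.mod_eq_of_lt hi, Nat.mod_eq_of_lt ho] at this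
            omega
          · convert he using 1
            ext t; simp; tauto
    have h0 : φ 0 ∈ M := (hMmem _).2 ⟨0, by omega, by omega, rfl⟩
    have h2 : φ 2 ∈ M := (hMmem _).2 ⟨2, by omega, by omega, rfl⟩
    rcases hc.1.2 M hMmod with h | h | ⟨v, h⟩
    · rw [h] at h0; simp at h0
    · have : φ 1 ∈ M := by rw [h]; exact hφV 1
      obtain ⟨i, hi, hi2, h⟩ := (hMmem _).1 this
      have := hφinj _ _ h
      rw [Nat.mod_eq_of_lt hi, Nat.mod_eq_of_lt (by omega)] at this
      omega
    · rw [h] at h0 h2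
      simp only [Finset.mem_singleton] at h0 h2
      exact hφne 0 2 (by omega) (by omega) (h0.trans h2.symm)
  · -- odd length: the cycle spans
    let C : Finset α := (Finset.range m).image φ
    have hCmem : ∀ v, v ∈ C ↔ ∃ i, i < m ∧ φ i = v := by
      intro v; simp [C]
    have hout : ∀ v, v ∉ C → ∀ l, v ≠ φ l := by
      rintro v hv l rfl
      exact hv ((hCmem _).2 ⟨l % m, Nat.mod_lt _ hm0, by rw [hφ, hφ, Nat.mod_mod]⟩)
    have hCmod : IsModule verts edges C := by
      apply mkModule h3
      · intro v hv
        obtain ⟨i, -, rfl⟩ := (hCmem v).1 hv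
        exact hφV i
      · intro a ha b hb hab u hu
        obtain ⟨i, hi, rfl⟩ := (hCmem a).1 ha
        obtain ⟨j, hj, rfl⟩ := (hCmem b).1 hb
        have hij : i ≠ j := by rintro rfl; exact hab rfl
        clear hab ha hb
        revert hi hj
        refine wlog_lt (P := fun i j => i < m → j < m → ({φ i, φ j, u} : Finset α) ∉ edges)
          ?_ ?_ i j hij
        · intro i j h h1 h2
          rw [Finset.insert_comm]; exact h h2 h1
        · intro i j hij hi hj
          by_cases hp : i % 2 = j % 2
          · have := ZZ i ((j - i)/2) (by omega) (by omega) u (fun t ht => hout u hu _)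
            rwa [show i + 2 * ((j - i)/2) = j by omega] at this
          · have := ZZ j ((i + m - j)/2) (by omega) (by omega) u (fun t ht => hout u hu _)
            rwa [show j + 2 * ((i+m-j)/2) = i + m by omega, hper, Finset.insert_comm] at this
      · intro a ha b hb hab u w hu hw he
        obtain ⟨i, hi, rfl⟩ := (hCmem a).1 ha
        obtain ⟨j, hj, rfl⟩ := (hCmem b).1 hb
        by_cases hp : i % 2 = j % 2
        · have := MV i ((j + 2 * m - i)/2) u w (fun t ht => hout u hu _) (fun t ht => hout w hw _)
          rw [show i + 2 * ((j + 2 * m - i)/2) = j + m + m by omega, hper, hper] at this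
          exact this.1 he
        · have := MV i ((j + m - i)/2) u w (fun t ht => hout u hu _) (fun t ht => hout w hw _)
          rw [show i + 2 * ((j + m - i)/2) = j + m by omega, hper] at this
          exact this.1 he
    have hCV : C = verts := by
      have h0 : φ 0 ∈ C := (hCmem _).2 ⟨0, by omega, rfl⟩
      have h1 : φ 1 ∈ C := (hCmem _).2 ⟨1, by omega, rfl⟩
      rcases hc.1.2 C hCmod with h | h | ⟨v, h⟩
      · rw [h] at h0; simp at h0
      · exact h
      · rw [h] at h0 h1
        simp only [Finset.mem_singleton] at h0 h1
        exact absurd (h0.trans h1.symm) (hφne 0 1 (by omega) (by omega))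
    have hcard : verts.card = m := by
      rw [← hCV, Finset.card_image_of_injOn, Finset.card_range]
      intro i hi j hj h
      have := hφinj i j h
      simp at hi hj
      rwa [Nat.mod_eq_of_lt hi, Nat.mod_eq_of_lt hj] at this
    have hm5 : 5 ≤ m := by omega
    -- non-alternating triples are not edges
    have N1 : ∀ a b c, a < b → b < c → c < m → ({φ a, φ b, φ c} : Finset α) ∈ edges →
        a % 2 ≠ b % 2 ∧ b % 2 ≠ c % 2 := by
      intro a b c h1 h2 h3 he
      constructor
      · intro hp
        apply ZZ a ((b-a)/2) (by omega) (by omega) (φ c)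
          (fun t ht => (hφne _ _ (by omega) (by omega)).symm)
        rwa [show a + 2 * ((b - a)/2) = b by omega]
      · intro hp
        apply ZZ b ((c-b)/2) (by omega) (by omega) (φ a)
          (fun t ht => (hφne _ _ (by omega) (by omega)))
        rw [show b + 2 * ((c - b)/2) = c by omega]
        convert he using 1
        ext t; simp; tauto
    have S : ∀ i, ({φ i, φ (i+1), φ (i+2)} : Finset α) ∈ edges ↔
        ({φ 0, φ 1, φ 2} : Finset α) ∈ edges := by
      intro i
      induction i with
      | zero => simp
      | succ i ih =>
        rw [← ih]
        have := MV (i+3) ((m-3)/2) (φ (i+1)) (φ (i+2))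
          (fun t ht => hφne _ _ (by omega) (by omega)) (fun t ht => hφne _ _ (by omega) (by omega))
        rw [show i + 3 + 2 * ((m-3)/2) = i + m by omega, hper] at this
        rw [← this]
        have : ({φ (i+1), φ (i+1+1), φ (i+1+2)} : Finset α) = {φ (i+3), φ (i+1), φ (i+2)} := by
          ext t; simp [show i+1+1 = i+2 by ring, show i+1+2 = i+3 by ring]; tauto
        rw [this]
    have T : ∀ a b c, a < b → b < c → c < m → a % 2 ≠ b % 2 → b % 2 ≠ c % 2 →
        (({φ a, φ b, φ c} : Finset α) ∈ edges ↔ ({φ 0, φ 1, φ 2} : Finset α) ∈ edges) := by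
      intro a b c h1 h2 h3 h4 h5
      rw [← S a]
      have e1 := MV (a+1) ((b-(a+1))/2) (φ a) (φ c)
        (fun t ht => hφne _ _ (by omega) (by omega))
        (fun t ht => (hφne _ _ (by omega) (by omega)).symm)
      rw [show a + 1 + 2 * ((b-(a+1))/2) = b by omega] at e1
      have e2 := MV (a+2) ((c-(a+2))/2) (φ a) (φ (a+1))
        (fun t ht => hφne _ _ (by omega) (by omega))
        (fun t ht => hφne _ _ (by omega) (by omega))
      rw [show a + 2 + 2 * ((c-(a+2))/2) = c by omega] at e2
      rw [Finset.insert_comm, ← e1]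
      have r1 : ({φ (a+1), φ a, φ c} : Finset α) = {φ c, φ a, φ (a+1)} := by
        ext t; simp; tauto
      have r2 : ({φ a, φ (a+1), φ (a+2)} : Finset α) = {φ (a+2), φ a, φ (a+1)} := by
        ext t; simp; tauto
      rw [r1, r2, e2]
    -- every edge is a sorted triple
    have sorted : ∀ e ∈ edges, ∃ a b c, a < b ∧ b < c ∧ c < m ∧
        e = ({φ a, φ b, φ c} : Finset α) := by
      intro e he
      have hs := h3 e he
      obtain ⟨x, y, z, hxy, hxz, hyz, rfl⟩ := Finset.card_eq_three.1 hs.2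
      have hx : x ∈ C := by rw [hCV]; exact hs.1 (by simp)
      have hy : y ∈ C := by rw [hCV]; exact hs.1 (by simp)
      have hz : z ∈ C := by rw [hCV]; exact hs.1 (by simp)
      obtain ⟨i, hi, rfl⟩ := (hCmem x).1 hx
      obtain ⟨j, hj, rfl⟩ := (hCmem y).1 hy
      obtain ⟨k, hk, rfl⟩ := (hCmem z).1 hz
      have hij : i ≠ j := by rintro rfl; exact hxy rfl
      have hik : i ≠ k := by rintro rfl; exact hxz rfl
      have hjk : j ≠ k := by rintro rfl; exact hyz rfl
      have : (i < j ∧ j < k) ∨ (i < k ∧ k < j) ∨ (j < i ∧ i < k) ∨ (j < k ∧ k < i) ∨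
        (k < i ∧ i < j) ∨ (k < j ∧ j < i) := by omega
      rcases this with h | h | h | h | h | h
      · exact ⟨i, j, k, h.1, h.2, hk, rfl⟩
      · exact ⟨i, k, j, h.1, h.2, hj, by ext t; simp; tauto⟩
      · exact ⟨j, i, k, h.1, h.2, hk, by ext t; simp; tauto⟩
      · exact ⟨j, k, i, h.1, h.2, hi, by ext t; simp; tauto⟩
      · exact ⟨k, i, j, h.1, h.2, hj, by ext t; simp; tauto⟩
      · exact ⟨k, j, i, h.1, h.2, hi, by ext t; simp; tauto⟩
    have E0 : ({φ 0, φ 1, φ 2} : Finset α) ∈ edges := by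
      by_contra hne
      have hempty : ∀ e, e ∉ edges := by
        intro e he
        obtain ⟨a, b, c, h1, h2, h4, rfl⟩ := sorted e he
        obtain ⟨p, q⟩ := N1 a b c h1 h2 h4 he
        exact hne ((T a b c h1 h2 h4 p q).1 he)
      have hmod2 : IsModule verts edges {φ 0, φ 1} := by
        refine ⟨?_, fun e he => absurd he (hempty e)⟩
        intro v hv
        simp only [Finset.mem_insert, Finset.mem_singleton] at hv
        rcases hv with rfl | rfl <;> exact hφV _
      have c2 : ({φ 0, φ 1} : Finset α).card = 2 :=
        Finset.card_pair (hφne 0 1 (by omega) (by omega))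
      rcases hc.1.2 _ hmod2 with h | h | ⟨v, h⟩
      · rw [h] at c2; simp at c2
      · rw [h] at c2; omega
      · rw [h] at c2; simp at c2
    have ex : ∀ v, ∃ i, v ∈ verts → i < m ∧ φ i = v := by
      intro v
      by_cases hv : v ∈ verts
      · rw [← hCV] at hv
        obtain ⟨i, hi⟩ := (hCmem v).1 hv
        exact ⟨i, fun _ => hi⟩
      · exact ⟨0, fun h => absurd h hv⟩
    choose f hf using ex
    have hfφ : ∀ i < m, f (φ i) = i := by
      intro i hi
      have h := hf (φ i) (hφV i)
      have := hφinj _ _ h.2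
      rwa [Nat.mod_eq_of_lt hi, Nat.mod_eq_of_lt h.1] at this
    refine ⟨?_, f, ?_, ?_, ?_⟩
    · rw [hcard]; exact Nat.odd_iff.2 hpar
    · intro v hv w hw h
      rw [← (hf v hv).2, ← (hf w hw).2, h]
    · ext i
      rw [hcard, Finset.mem_image, Finset.mem_range]
      constructor
      · rintro ⟨v, hv, rfl⟩; exact (hf v hv).1
      · intro hi; exact ⟨φ i, hφV i, hfφ i hi⟩
    · intro e heV
      rw [hcard, c3_iff]
      constructor
      · intro he
        obtain ⟨a, b, c, h1, h2, h4, rfl⟩ := sorted e he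
        obtain ⟨p, q⟩ := N1 a b c h1 h2 h4 he
        refine ⟨a, b, c, h1, h2, h4, p, q, ?_⟩
        simp only [Finset.image_insert, Finset.image_singleton]
        rw [hfφ a (by omega), hfφ b (by omega), hfφ c (by omega)]
      · rintro ⟨a, b, c, h1, h2, h4, p, q, he⟩
        have : e = {φ a, φ b, φ c} := by
          have h := congrArg (Finset.image φ) he
          rw [Finset.image_image] at h
          simp only [Finset.image_insert, Finset.image_singleton] at h
          rw [← h]
          ext v
          rw [Finset.mem_image]
          constructor
          · intro hv; exact ⟨v, hv, (hf v (heV hv)).2⟩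
          · rintro ⟨w, hw, rfl⟩
            simp only [Function.comp]
            rwa [(hf w (heV hw)).2]
        rw [this, T a b c h1 h2 h4 p q]
        exact E0

theorem circular_iff_primality_graph_has_cycle_component {α : Type*} [DecidableEq α]
    (verts : Finset α) (edges : Set (Finset α)) (h3 : Is3Hypergraph verts edges)
    (hc : IsCritical verts edges) (h5 : 5 ≤ verts.card) :
    IsCircular verts edges ↔
      ∃ (m : ℕ) (ψ : ℕ → α), 3 ≤ m ∧ Set.InjOn ψ (Set.Iio m) ∧
        (∀ i < m, ψ i ∈ verts) ∧
        (∀ i < m, ∀ j < m, (PrimAdj verts edges (ψ i) (ψ j) ↔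
          (j = (i + 1) % m ∨ i = (j + 1) % m))) ∧
        (∀ i < m, ∀ w, PrimAdj verts edges (ψ i) w → ∃ j < m, w = ψ j) := by
  constructor
  · exact forward verts edges hc h5
  · rintro ⟨m, ψ, hm, hinj, hV, hadj, -⟩
    exact backward verts edges h3 hc h5 m ψ hm hinj hV hadj
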